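/- Let n ≥ 2 and let ‖·‖ : ℝⁿ → [0,∞) be a continuous function with ‖x‖ > 0 for x ≠ 0, ‖cx‖ = c‖x‖ for all c > 0, and ‖x+y‖ ≤ ‖x‖ + ‖y‖; set d(x,y) := ‖y−x‖ and let ‖α‖_* := sup{α(x) : ‖x‖ ≤ 1} be the dual of a linear functional α. Let Φ : ℝⁿ → ℝ be continuous and K-convex for some K > 0, and let 𝔪 be the probability measure with density e^{−Φ} with respect to Lebesgue measure. Then the global Poincaré inequality holds: for every Lipschitz function f : ℝⁿ → ℝ with compact support, ∫_{ℝⁿ} f² d𝔪 − (∫_{ℝⁿ} f d𝔪)² ≤ (1/K) ∫_{ℝⁿ} ‖Df(x)‖_*² d𝔪(x), where Df(x) denotes the (Lebesgue-almost-everywhere defined) derivative of f. -/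

import Mathlib

open MeasureTheory

/-- The dual norm of a linear functional `α` with respect to an asymmetric norm
`Nm`: `‖α‖_* := sup { α x | Nm x ≤ 1 }`. -/
noncomputable def dualNorm {n : ℕ} (Nm : (Fin n → ℝ) → ℝ)
    (α : (Fin n → ℝ) →L[ℝ] ℝ) : ℝ :=
  sSup {r : ℝ | ∃ x : Fin n → ℝ, Nm x ≤ 1 ∧ r = α x}

open Set Filter Topology
open scoped ENNReal NNReal Pointwise

theorem IsCompact.volume_add_volume_le_volume_add {s t : Set ℝ} (hs : IsCompact s)
    (ht : IsCompact t) (hs₀ : s.Nonempty) (ht₀ : t.Nonempty) :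
    volume s + volume t ≤ volume (s + t) := by
  obtain ⟨a, ha, hamax⟩ := hs.exists_isGreatest hs₀
  obtain ⟨b, hb, hbmin⟩ := ht.exists_isLeast ht₀
  have hdisj : AEDisjoint volume (Set.image (fun x => b + x) s) (Set.image (fun x => a + x) t) := by
    refine measure_mono_null (t := {a + b}) ?_ (by simp)
    rintro _ ⟨⟨x, hx, rfl⟩, y, hy, hxy⟩
    have h1 := hamax hx
    have h2 := hbmin hy
    simp only [mem_singleton_iff] at hxy ⊢
    linarith
  have hmeas : NullMeasurableSet (Set.image (fun x => a + x) t) volume :=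
    (ht.image (by fun_prop)).measurableSet.nullMeasurableSet
  calc volume s + volume t
      = volume (Set.image (fun x => b + x) s) + volume (Set.image (fun x => a + x) t) := by
        simp [measure_preimage_add]
    _ = volume ((Set.image (fun x => b + x) s) ∪ (Set.image (fun x => a + x) t)) :=
        (measure_union₀ hmeas hdisj).symm
    _ ≤ volume (s + t) := by
        refine measure_mono (union_subset ?_ ?_)
        · rintro _ ⟨x, hx, rfl⟩
          exact ⟨x, hx, b, hb, add_comm _ _⟩
        · rintro _ ⟨y, hy, rfl⟩
          exact ⟨a, ha, y, hy, rfl⟩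

/-- The one-dimensional Brunn-Minkowski inequality. -/
theorem Real.volume_add_volume_le_volume_add {s t : Set ℝ} (hs : MeasurableSet s)
    (ht : MeasurableSet t) (hs₀ : s.Nonempty) (ht₀ : t.Nonempty) :
    volume s + volume t ≤ volume (s + t) := by
  have approx : ∀ {u : Set ℝ}, MeasurableSet u → ∀ {r}, r < volume u →
      ∃ k ⊆ u, IsCompact k ∧ k.Nonempty ∧ r < volume k := by
    intro u hu r hr
    obtain ⟨k, hku, hk, hrk⟩ := hu.exists_lt_isCompact hr
    exact ⟨k, hku, hk, nonempty_of_measure_ne_zero (pos_of_gt hrk).ne', hrk⟩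
  rcases eq_or_ne (volume s) 0 with hs0 | hs0
  · obtain ⟨a, ha⟩ := hs₀
    rw [hs0, zero_add, ← measure_preimage_add volume (-a) t]
    refine measure_mono fun x hx => ⟨a, ha, -a + x, hx, by simp⟩
  rcases eq_or_ne (volume t) 0 with ht0 | ht0
  · obtain ⟨b, hb⟩ := ht₀
    rw [ht0, add_zero, ← measure_preimage_add volume (-b) s]
    refine measure_mono fun x hx => ⟨-b + x, hx, b, hb, by simp⟩
  refine le_of_forall_lt fun r hr => ?_
  obtain ⟨p, hp, q, hq, hpq⟩ := ENNReal.exists_lt_add_of_lt_add hr hs0 ht0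
  obtain ⟨k, hks, hk, hk₀, hpk⟩ := approx hs hp
  obtain ⟨l, hlt, hl, hl₀, hql⟩ := approx ht hq
  calc r < p + q := hpq
    _ ≤ volume k + volume l := add_le_add hpk.le hql.le
    _ ≤ volume (k + l) := hk.volume_add_volume_le_volume_add hl hk₀ hl₀
    _ ≤ volume (s + t) := measure_mono (add_subset_add hks hlt)

theorem ENNReal.four_mul_mul_le_sq_add (a b : ℝ≥0∞) : 4 * (a * b) ≤ (a + b) ^ 2 := by
  wlog h : a ≤ b generalizing a b
  · rw [mul_comm a b, add_comm a b]
    exact this b a (le_of_not_ge h)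
  obtain ⟨d, rfl⟩ := exists_add_of_le h
  calc 4 * (a * (a + d)) ≤ 4 * (a * (a + d)) + d ^ 2 := le_self_add
    _ = (a + (a + d)) ^ 2 := by ring

theorem lintegral_eq_lintegral_meas_ofReal_lt {α : Type*} [MeasurableSpace α] {μ : Measure α}
    {f : α → ℝ≥0∞} (hf : Measurable f) (hf_top : ∀ x, f x ≠ ∞) :
    ∫⁻ x, f x ∂μ = ∫⁻ t in Ioi (0 : ℝ), μ {x | ENNReal.ofReal t < f x} := by
  have h := lintegral_eq_lintegral_meas_lt μ (f := fun x => (f x).toReal)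
    (Eventually.of_forall fun x => ENNReal.toReal_nonneg) hf.ennreal_toReal.aemeasurable
  simp only [ENNReal.ofReal_toReal (hf_top _)] at h
  rw [h]
  refine setLIntegral_congr_fun measurableSet_Ioi fun t ht => ?_
  simp only [ENNReal.ofReal_lt_iff_lt_toReal (le_of_lt ht) (hf_top _)]

/-- The additive form of the one-dimensional Prékopa-Leindler inequality, for functions with
supremum `1`. -/
theorem lintegral_add_lintegral_le_of_mul_le_midpoint_sq {f g h : ℝ → ℝ≥0∞} (hf : Measurable f)
    (hg : Measurable g) (hh : Measurable h) (hf1 : ∀ x, f x ≤ 1) (hg1 : ∀ x, g x ≤ 1)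
    (hf_sup : ∀ t < 1, ∃ x, t < f x) (hg_sup : ∀ t < 1, ∃ x, t < g x)
    (hfgh : ∀ x y, f x * g y ≤ h ((2 : ℝ)⁻¹ • (x + y)) ^ 2) :
    (∫⁻ x, f x) + ∫⁻ x, g x ≤ 2 * ∫⁻ x, h x := by
  have hk : Measurable fun x => min (h x) 1 := hh.min measurable_const
  have hk_le : ∫⁻ x, min (h x) 1 ≤ ∫⁻ x, h x := lintegral_mono fun x => min_le_left _ _
  refine le_trans ?_ (mul_le_mul_right hk_le 2)
  have anti : ∀ u : ℝ → ℝ≥0∞, Measurable fun t : ℝ => volume {x | ENNReal.ofReal t < u x} :=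
    fun u => Antitone.measurable fun s t hst =>
      measure_mono fun x hx => (ENNReal.ofReal_le_ofReal hst).trans_lt hx
  rw [lintegral_eq_lintegral_meas_ofReal_lt hf fun x => ((hf1 x).trans_lt ENNReal.one_lt_top).ne,
    lintegral_eq_lintegral_meas_ofReal_lt hg fun x => ((hg1 x).trans_lt ENNReal.one_lt_top).ne,
    lintegral_eq_lintegral_meas_ofReal_lt hk
      fun x => ((min_le_right _ _).trans_lt ENNReal.one_lt_top).ne,
    ← lintegral_add_left (anti f), ← lintegral_const_mul _ (anti _)]
  refine lintegral_mono fun t => ?_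
  dsimp only
  rcases lt_or_ge (ENNReal.ofReal t) 1 with ht | ht
  · refine (Real.volume_add_volume_le_volume_add (measurableSet_lt measurable_const hf)
      (measurableSet_lt measurable_const hg) (hf_sup _ ht) (hg_sup _ ht)).trans ?_
    have hsmul : volume ((2 : ℝ) • {x | ENNReal.ofReal t < min (h x) 1}) =
        2 * volume {x | ENNReal.ofReal t < min (h x) 1} := by
      simp [Measure.addHaar_smul]
    rw [← hsmul]
    refine measure_mono ?_
    rintro _ ⟨x, hx, y, hy, rfl⟩
    refine ⟨(2 : ℝ)⁻¹ • (x + y), lt_min ?_ ht, by simp⟩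
    refine lt_of_not_ge fun hle => ?_
    refine absurd ((hfgh x y).trans (pow_le_pow_left' hle 2)) (not_le.2 ?_)
    rw [sq]
    exact ENNReal.mul_lt_mul hx hy
  · have hf0 : {x | ENNReal.ofReal t < f x} = ∅ :=
      eq_empty_of_forall_notMem fun x hx => absurd (hf1 x) (not_le.2 (ht.trans_lt hx))
    have hg0 : {x | ENNReal.ofReal t < g x} = ∅ :=
      eq_empty_of_forall_notMem fun x hx => absurd (hg1 x) (not_le.2 (ht.trans_lt hx))
    simp [hf0, hg0]

/-- `PrekopaLeindler μ` says that `μ` satisfies the Prékopa-Leindler inequality at midpoints. -/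
def PrekopaLeindler {E : Type*} [AddCommGroup E] [Module ℝ E] [MeasurableSpace E]
    (μ : Measure E) : Prop :=
  ∀ ⦃f g h : E → ℝ≥0∞⦄, Measurable f → Measurable g → Measurable h →
    (∀ x y, f x * g y ≤ h ((2 : ℝ)⁻¹ • (x + y)) ^ 2) →
    (∫⁻ x, f x ∂μ) * ∫⁻ x, g x ∂μ ≤ (∫⁻ x, h x ∂μ) ^ 2

theorem lintegral_mul_lintegral_le_sq_of_bounded {f g h : ℝ → ℝ≥0∞} (hf : Measurable f)
    (hg : Measurable g) (hh : Measurable h) (hf_top : ⨆ x, f x ≠ ∞) (hg_top : ⨆ x, g x ≠ ∞)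
    (hfgh : ∀ x y, f x * g y ≤ h ((2 : ℝ)⁻¹ • (x + y)) ^ 2) :
    (∫⁻ x, f x) * ∫⁻ x, g x ≤ (∫⁻ x, h x) ^ 2 := by
  set a := ⨆ x, f x
  set b := ⨆ x, g x
  rcases eq_or_ne a 0 with ha0 | ha0
  · have : ∀ x, f x = 0 := fun x => le_zero_iff.1 (ha0 ▸ le_iSup f x)
    simp [this]
  rcases eq_or_ne b 0 with hb0 | hb0
  · have : ∀ x, g x = 0 := fun x => le_zero_iff.1 (hb0 ▸ le_iSup g x)
    simp [this]
  obtain ⟨c, hc⟩ : ∃ c : ℝ≥0∞, c ^ 2 = (a * b)⁻¹ :=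
    ⟨(a * b)⁻¹ ^ (2⁻¹ : ℝ), by rw [← ENNReal.rpow_natCast, ← ENNReal.rpow_mul]; simp⟩
  have sup_one : ∀ {u : ℝ → ℝ≥0∞}, ⨆ x, u x ≠ ∞ → ⨆ x, u x ≠ 0 →
      ∀ t < 1, ∃ x, t < (⨆ x, u x)⁻¹ * u x := by
    intro u hu hu0 t ht
    rw [← lt_iSup_iff, ← ENNReal.mul_iSup, ENNReal.inv_mul_cancel hu0 hu]
    exact ht
  have le_one : ∀ {u : ℝ → ℝ≥0∞}, ∀ x, (⨆ x, u x)⁻¹ * u x ≤ 1 := by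
    intro u x
    exact (mul_le_mul_right (le_iSup u x) _).trans (ENNReal.inv_mul_le_one _)
  have key := lintegral_add_lintegral_le_of_mul_le_midpoint_sq (hf.const_mul a⁻¹)
    (hg.const_mul b⁻¹) (hh.const_mul c) le_one le_one (sup_one hf_top ha0) (sup_one hg_top hb0)
    (fun x y => by
      rw [mul_pow, hc, ENNReal.mul_inv (Or.inl ha0) (Or.inl hf_top)]
      calc a⁻¹ * f x * (b⁻¹ * g y) = a⁻¹ * b⁻¹ * (f x * g y) := by ring
        _ ≤ _ := mul_le_mul_right (hfgh x y) _)
  rw [lintegral_const_mul _ hf, lintegral_const_mul _ hg, lintegral_const_mul _ hh] at key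
  have h4 := (ENNReal.four_mul_mul_le_sq_add _ _).trans (pow_le_pow_left' key 2)
  have hab0 : a * b ≠ 0 := mul_ne_zero ha0 hb0
  have habt : a * b ≠ ∞ := ENNReal.mul_ne_top hf_top hg_top
  have h5 : 4 * (a * b)⁻¹ * ((∫⁻ x, f x) * ∫⁻ x, g x) ≤ 4 * (a * b)⁻¹ * (∫⁻ x, h x) ^ 2 := by
    calc 4 * (a * b)⁻¹ * ((∫⁻ x, f x) * ∫⁻ x, g x)
        = 4 * (a⁻¹ * (∫⁻ x, f x) * (b⁻¹ * ∫⁻ x, g x)) := by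
          rw [ENNReal.mul_inv (Or.inl ha0) (Or.inl hf_top)]; ring
      _ ≤ (2 * (c * ∫⁻ x, h x)) ^ 2 := h4
      _ = 4 * (a * b)⁻¹ * (∫⁻ x, h x) ^ 2 := by rw [← hc]; ring
  exact (ENNReal.mul_le_mul_iff_right (mul_ne_zero (by simp) (ENNReal.inv_ne_zero.2 habt))
    (ENNReal.mul_ne_top (by simp) (ENNReal.inv_ne_top.2 hab0))).1 h5

theorem lintegral_eq_iSup_lintegral_min_natCast {α : Type*} [MeasurableSpace α] {μ : Measure α}
    {f : α → ℝ≥0∞} (hf : Measurable f) : ∫⁻ x, f x ∂μ = ⨆ n : ℕ, ∫⁻ x, min (f x) n ∂μ := by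
  rw [← lintegral_iSup (fun n => hf.min measurable_const)
    fun m n hmn x => min_le_min_left _ (by exact_mod_cast hmn)]
  refine lintegral_congr fun x => ?_
  have := inf_iSup_eq (f x) fun n : ℕ => (n : ℝ≥0∞)
  rw [ENNReal.iSup_natCast, inf_top_eq] at this
  exact this

theorem prekopaLeindler_real : PrekopaLeindler (volume : Measure ℝ) := by
  intro f g h hf hg hh hfgh
  rw [lintegral_eq_iSup_lintegral_min_natCast hf, lintegral_eq_iSup_lintegral_min_natCast hg,
    ENNReal.iSup_mul]
  refine iSup_le fun m => ?_
  rw [ENNReal.mul_iSup]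
  refine iSup_le fun n => ?_
  refine lintegral_mul_lintegral_le_sq_of_bounded (hf.min measurable_const)
    (hg.min measurable_const) hh ?_ ?_
    fun x y => (mul_le_mul' (min_le_left _ _) (min_le_left _ _)).trans (hfgh x y)
  · exact ((iSup_le fun x => min_le_right _ _).trans_lt (ENNReal.natCast_lt_top m)).ne
  · exact ((iSup_le fun x => min_le_right _ _).trans_lt (ENNReal.natCast_lt_top n)).ne

theorem PrekopaLeindler.prod {E F : Type*} [AddCommGroup E] [Module ℝ E] [MeasurableSpace E]
    [AddCommGroup F] [Module ℝ F] [MeasurableSpace F] {μ : Measure E} {ν : Measure F}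
    [SFinite μ] [SFinite ν] (hμ : PrekopaLeindler μ) (hν : PrekopaLeindler ν) :
    PrekopaLeindler (μ.prod ν) := by
  intro f g h hf hg hh hfgh
  rw [lintegral_prod _ hf.aemeasurable, lintegral_prod _ hg.aemeasurable,
    lintegral_prod _ hh.aemeasurable]
  refine hμ hf.lintegral_prod_right' hg.lintegral_prod_right' hh.lintegral_prod_right'
    fun x y => ?_
  exact hν (hf.comp measurable_prodMk_left) (hg.comp measurable_prodMk_left)
    (hh.comp measurable_prodMk_left) fun u v => hfgh (x, u) (y, v)

theorem prekopaLeindler_pi (n : ℕ) : PrekopaLeindler (volume : Measure (Fin n → ℝ)) := by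
  induction n with
  | zero =>
    intro f g h _ _ _ hfgh
    have hvol : (volume : Measure (Fin 0 → ℝ)) univ = 1 := by simp [volume_pi]
    simp only [lintegral_unique, hvol, mul_one]
    convert hfgh default default
  | succ n ih =>
    intro f g h hf hg hh hfgh
    have hmp := (volume_preserving_piFinSuccAbove (fun _ : Fin (n + 1) => ℝ) 0).symm
    rw [← hmp.lintegral_comp hf, ← hmp.lintegral_comp hg, ← hmp.lintegral_comp hh]
    refine prekopaLeindler_real.prod ih (hf.comp hmp.measurable) (hg.comp hmp.measurable)
      (hh.comp hmp.measurable) fun x y => ?_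
    convert hfgh _ _ using 3
    ext i
    refine Fin.cases ?_ (fun j => ?_) i <;> simp [MeasurableEquiv.piFinSuccAbove, mul_add]

theorem exp_le_cubic {s : ℝ} (hs : |s| ≤ 1) : Real.exp s ≤ 1 + s + s ^ 2 / 2 + |s| ^ 3 := by
  have h := (abs_le.1 (Real.exp_bound hs (n := 3) (by norm_num))).2
  have h3 : (0 : ℝ) ≤ |s| ^ 3 := by positivity
  norm_num [Finset.sum_range_succ, Nat.factorial] at h
  linarith

theorem cubic_le_exp {s : ℝ} (hs : |s| ≤ 1) : 1 + s + s ^ 2 / 2 - |s| ^ 3 ≤ Real.exp s := by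
  have h := (abs_le.1 (Real.exp_bound hs (n := 3) (by norm_num))).1
  have h3 : (0 : ℝ) ≤ |s| ^ 3 := by positivity
  norm_num [Finset.sum_range_succ, Nat.factorial] at h
  linarith

/-- Second-order expansion of the inequality `∫ exp (2 ε f) ≤ (∫ exp (ε f + ε² g))²`. -/
theorem integral_sq_le_of_integral_exp_le {α : Type*} [MeasurableSpace α] {μ : Measure α}
    [IsProbabilityMeasure μ] {f g : α → ℝ} (hf : Measurable f) (hg : Measurable g) {M C ε : ℝ}
    (hfM : ∀ x, |f x| ≤ M) (hg0 : ∀ x, 0 ≤ g x) (hgC : ∀ x, g x ≤ C) (hε : 0 < ε) (hε1 : ε ≤ 1)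
    (hεS : 2 * (ε * (M + C)) ≤ 1)
    (h : ∫ x, Real.exp (2 * (ε * f x)) ∂μ ≤ (∫ x, Real.exp (ε * f x + ε ^ 2 * g x) ∂μ) ^ 2) :
    ∫ x, f x ^ 2 ∂μ ≤ 2 * ∫ x, g x ∂μ +
      ((∫ x, f x ∂μ) + ε * ((∫ x, f x ^ 2 ∂μ) / 2 + ∫ x, g x ∂μ) +
        ((M + C) ^ 2 + 8 * (M + C) ^ 3) * ε ^ 2) ^ 2 +
      3 * ((M + C) ^ 2 + 8 * (M + C) ^ 3) * ε := by
  obtain ⟨x₀⟩ : Nonempty α := nonempty_of_isProbabilityMeasure μ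
  have hM : 0 ≤ M := (abs_nonneg _).trans (hfM x₀)
  have hC : 0 ≤ C := (hg0 x₀).trans (hgC x₀)
  set S := M + C with hS
  set B := S ^ 2 + 8 * S ^ 3 with hB
  have hS0 : 0 ≤ S := by positivity
  have bdd_int : ∀ {u : α → ℝ} (A : ℝ), Measurable u → (∀ x, |u x| ≤ A) → Integrable u μ :=
    fun A hu hA => Integrable.of_bound hu.aestronglyMeasurable A (Eventually.of_forall hA)
  have hfi : Integrable f μ := bdd_int M hf hfM
  have hgi : Integrable g μ := bdd_int C hg fun x => by rw [abs_of_nonneg (hg0 x)]; exact hgC x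
  have hf2i : Integrable (fun x => f x ^ 2) μ := bdd_int (M ^ 2) (hf.pow_const 2) fun x => by
    rw [abs_pow]; exact pow_le_pow_left₀ (abs_nonneg _) (hfM x) 2
  have hs1 : ∀ x, |2 * (ε * f x)| ≤ 2 * (ε * S) := fun x => by
    rw [abs_mul, abs_mul, abs_of_pos hε, abs_of_pos (two_pos : (0 : ℝ) < 2)]
    have := hfM x
    gcongr
    linarith
  have hs2 : ∀ x, |ε * f x + ε ^ 2 * g x| ≤ ε * S := fun x => by
    have h1 : |ε * f x| ≤ ε * M := by
      rw [abs_mul, abs_of_pos hε]; exact mul_le_mul_of_nonneg_left (hfM x) hε.le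
    have h2 : |ε ^ 2 * g x| ≤ ε * C := by
      rw [abs_of_nonneg (by have := hg0 x; positivity)]
      have : ε ^ 2 ≤ ε := by nlinarith
      exact mul_le_mul this (hgC x) (hg0 x) hε.le
    calc _ ≤ _ := abs_add_le _ _
      _ ≤ ε * S := by rw [hS, mul_add]; linarith
  have hεS0 : 0 ≤ ε * S := by positivity
  have lower : 1 + 2 * (ε * ∫ x, f x ∂μ) + 2 * (ε ^ 2 * ∫ x, f x ^ 2 ∂μ) - B * ε ^ 3 ≤
      ∫ x, Real.exp (2 * (ε * f x)) ∂μ := by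
    have hint : ∫ x, (1 + 2 * (ε * f x) + 2 * (ε ^ 2 * f x ^ 2) - B * ε ^ 3) ∂μ =
        1 + 2 * (ε * ∫ x, f x ∂μ) + 2 * (ε ^ 2 * ∫ x, f x ^ 2 ∂μ) - B * ε ^ 3 := by
      rw [integral_sub (by fun_prop) (by fun_prop), integral_add (by fun_prop) (by fun_prop),
        integral_add (by fun_prop) (by fun_prop)]
      simp [integral_const_mul]
    rw [← hint]
    refine integral_mono (by fun_prop) (bdd_int (Real.exp 1) (by fun_prop) fun x => ?_)
      fun x => ?_
    · rw [abs_of_pos (Real.exp_pos _)]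
      exact Real.exp_le_exp.2 ((le_abs_self _).trans ((hs1 x).trans hεS))
    · have h1 := cubic_le_exp ((hs1 x).trans hεS)
      have h2 := pow_le_pow_left₀ (abs_nonneg _) (hs1 x) 3
      have h3 : 0 ≤ S ^ 2 * ε ^ 3 := by positivity
      dsimp only
      rw [hB]
      nlinarith
  have upper : ∫ x, Real.exp (ε * f x + ε ^ 2 * g x) ∂μ ≤
      1 + ε * (∫ x, f x ∂μ) + ε ^ 2 * ((∫ x, f x ^ 2 ∂μ) / 2 + ∫ x, g x ∂μ) + B * ε ^ 3 := by
    have hint : ∫ x, (1 + ε * f x + ε ^ 2 * (f x ^ 2 / 2 + g x) + B * ε ^ 3) ∂μ =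
        1 + ε * (∫ x, f x ∂μ) + ε ^ 2 * ((∫ x, f x ^ 2 ∂μ) / 2 + ∫ x, g x ∂μ) + B * ε ^ 3 := by
      rw [integral_add (by fun_prop) (by fun_prop), integral_add (by fun_prop) (by fun_prop),
        integral_add (by fun_prop) (by fun_prop), integral_const_mul, integral_const_mul,
        integral_add (by fun_prop) (by fun_prop), integral_div]
      simp
    rw [← hint]
    refine integral_mono (bdd_int (Real.exp 1) (by fun_prop) fun x => ?_) (by fun_prop)
      fun x => ?_
    · rw [abs_of_pos (Real.exp_pos _)]
      exact Real.exp_le_exp.2 ((le_abs_self _).trans ((hs2 x).trans (by linarith)))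
    · have h1 := exp_le_cubic ((hs2 x).trans (by linarith))
      have h2 := pow_le_pow_left₀ (abs_nonneg _) (hs2 x) 3
      have h3 : 0 ≤ S ^ 3 * ε ^ 3 := by positivity
      have h4 : 2 * (f x * g x) + ε * g x ^ 2 ≤ S ^ 2 := by
        have h5 : f x * g x ≤ M * C :=
          mul_le_mul ((le_abs_self _).trans (hfM x)) (hgC x) (hg0 x) hM
        have h6 : g x ^ 2 ≤ C ^ 2 := pow_le_pow_left₀ (hg0 x) (hgC x) 2
        have h7 : ε * g x ^ 2 ≤ 1 * C ^ 2 := mul_le_mul hε1 h6 (sq_nonneg _) zero_le_one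
        nlinarith [sq_nonneg M]
      have h8 := mul_le_mul_of_nonneg_left h4 (pow_pos hε 3).le
      have h9 : 0 ≤ S ^ 2 * ε ^ 3 := by positivity
      dsimp only
      rw [hB]
      nlinarith
  have upper0 : 0 ≤ ∫ x, Real.exp (ε * f x + ε ^ 2 * g x) ∂μ :=
    integral_nonneg fun x => (Real.exp_pos _).le
  have key := (lower.trans h).trans (pow_le_pow_left₀ upper0 upper 2)
  generalize ∫ x, f x ∂μ = a at *
  generalize ∫ x, f x ^ 2 ∂μ = b at *
  generalize ∫ x, g x ∂μ = G at *
  refine le_of_mul_le_mul_left ?_ (pow_pos hε 2)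
  nlinarith

section AsymmetricNorm

variable {n : ℕ} {Nm : (Fin n → ℝ) → ℝ}

theorem exists_pos_mul_norm_le (hNcont : Continuous Nm)
    (hNpos : ∀ x : Fin n → ℝ, x ≠ 0 → 0 < Nm x)
    (hNnonneg : ∀ x, 0 ≤ Nm x)
    (hNhomog : ∀ c : ℝ, 0 < c → ∀ x : Fin n → ℝ, Nm (c • x) = c * Nm x) :
    ∃ c > 0, ∀ x, c * ‖x‖ ≤ Nm x := by
  rcases (Metric.sphere (0 : Fin n → ℝ) 1).eq_empty_or_nonempty with he | hne
  · refine ⟨1, one_pos, fun x => ?_⟩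
    rcases eq_or_ne x 0 with rfl | hx
    · simpa using hNnonneg 0
    · have : ‖x‖⁻¹ • x ∈ Metric.sphere (0 : Fin n → ℝ) 1 := by
        simp [norm_smul, norm_ne_zero_iff.2 hx]
      simp [he] at this
  · obtain ⟨u, hu, hmin⟩ := (isCompact_sphere (0 : Fin n → ℝ) 1).exists_isMinOn hne
      hNcont.continuousOn
    have hu0 : u ≠ 0 := by rintro rfl; simp at hu
    refine ⟨Nm u, hNpos u hu0, fun x => ?_⟩
    rcases eq_or_ne x 0 with rfl | hx
    · simpa using hNnonneg 0
    · have hx' : 0 < ‖x‖ := norm_pos_iff.2 hx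
      have hmem : ‖x‖⁻¹ • x ∈ Metric.sphere (0 : Fin n → ℝ) 1 := by
        simp [norm_smul, hx'.ne']
      have h := hmin hmem
      rw [mem_ofPred_eq, hNhomog _ (inv_pos.2 hx'), inv_mul_eq_div, le_div_iff₀ hx'] at h
      exact h

theorem apply_zero_of_homog
    (hNhomog : ∀ c : ℝ, 0 < c → ∀ x : Fin n → ℝ, Nm (c • x) = c * Nm x) : Nm 0 = 0 := by
  have := hNhomog 2 two_pos 0
  rw [smul_zero] at this
  linarith

theorem apply_le_of_mul_norm_le {c : ℝ} (hc : 0 < c) (hcN : ∀ x, c * ‖x‖ ≤ Nm x)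
    (α : (Fin n → ℝ) →L[ℝ] ℝ) {x : Fin n → ℝ} (hx : Nm x ≤ 1) : α x ≤ ‖α‖ / c := by
  have h1 : ‖x‖ ≤ 1 / c := by
    rw [le_div_iff₀ hc, mul_comm]; exact (hcN x).trans hx
  calc α x ≤ ‖α x‖ := le_abs_self _
    _ ≤ ‖α‖ * ‖x‖ := α.le_opNorm x
    _ ≤ ‖α‖ * (1 / c) := by gcongr
    _ = ‖α‖ / c := by ring

theorem bddAbove_dualNorm {c : ℝ} (hc : 0 < c) (hcN : ∀ x, c * ‖x‖ ≤ Nm x)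
    (α : (Fin n → ℝ) →L[ℝ] ℝ) : BddAbove {r : ℝ | ∃ x : Fin n → ℝ, Nm x ≤ 1 ∧ r = α x} := by
  refine ⟨‖α‖ / c, ?_⟩
  rintro _ ⟨x, hx, rfl⟩
  exact apply_le_of_mul_norm_le hc hcN α hx

theorem dualNorm_nonneg {c : ℝ} (hc : 0 < c) (hcN : ∀ x, c * ‖x‖ ≤ Nm x) (hN0 : Nm 0 = 0)
    (α : (Fin n → ℝ) →L[ℝ] ℝ) : 0 ≤ dualNorm Nm α :=
  le_csSup (bddAbove_dualNorm hc hcN α) ⟨0, by simp [hN0], by simp⟩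

theorem dualNorm_le {c : ℝ} (hc : 0 < c) (hcN : ∀ x, c * ‖x‖ ≤ Nm x) (hN0 : Nm 0 = 0)
    (α : (Fin n → ℝ) →L[ℝ] ℝ) : dualNorm Nm α ≤ ‖α‖ / c := by
  refine csSup_le ⟨0, 0, by simp [hN0], by simp⟩ ?_
  rintro _ ⟨x, hx, rfl⟩
  exact apply_le_of_mul_norm_le hc hcN α hx

theorem apply_le_dualNorm_mul {c : ℝ} (hc : 0 < c) (hcN : ∀ x, c * ‖x‖ ≤ Nm x)
    (hNpos : ∀ x : Fin n → ℝ, x ≠ 0 → 0 < Nm x) (hN0 : Nm 0 = 0)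
    (hNhomog : ∀ c : ℝ, 0 < c → ∀ x : Fin n → ℝ, Nm (c • x) = c * Nm x)
    (α : (Fin n → ℝ) →L[ℝ] ℝ) (x : Fin n → ℝ) : α x ≤ dualNorm Nm α * Nm x := by
  rcases eq_or_ne x 0 with rfl | hx
  · simp [hN0]
  have hNx := hNpos x hx
  have h : (Nm x)⁻¹ * α x ≤ dualNorm Nm α :=
    le_csSup (bddAbove_dualNorm hc hcN α) ⟨(Nm x)⁻¹ • x,
      by rw [hNhomog _ (inv_pos.2 hNx), inv_mul_cancel₀ hNx.ne'], by simp⟩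
  rwa [inv_mul_eq_div, div_le_iff₀ hNx] at h

theorem measurable_dualNorm {c : ℝ} (hc : 0 < c) (hcN : ∀ x, c * ‖x‖ ≤ Nm x) :
    Measurable (dualNorm Nm) := by
  have heq : ∀ α : (Fin n → ℝ) →L[ℝ] ℝ,
      {r : ℝ | ∃ x : Fin n → ℝ, Nm x ≤ 1 ∧ r = α x} = range fun x : {x // Nm x ≤ 1} => α x := by
    intro α
    ext r
    simp [eq_comm]
  have : dualNorm Nm = fun α => ⨆ x : {x // Nm x ≤ 1}, α x := by
    funext α
    rw [dualNorm, heq, sSup_range]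
  rw [this]
  refine (lowerSemicontinuous_ciSup (fun α => ?_) fun x => ?_).measurable
  · rw [← heq]; exact bddAbove_dualNorm hc hcN α
  · exact (ContinuousLinearMap.apply ℝ ℝ (x : Fin n → ℝ)).continuous.lowerSemicontinuous

/-- The rescaled sup-convolution `sup_h ((f (z + ε h) - f z) / ε - K / 2 * Nm h ^ 2)`. -/
noncomputable def quadSlope (Nm : (Fin n → ℝ) → ℝ) (K : ℝ) (f : (Fin n → ℝ) → ℝ) (ε : ℝ)
    (z : Fin n → ℝ) : ℝ :=
  ⨆ h : Fin n → ℝ, ((f (z + ε • h) - f z) / ε - K / 2 * Nm h ^ 2)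

variable {K c ε : ℝ} {f : (Fin n → ℝ) → ℝ} {L : ℝ≥0}

theorem quadSlope_term_le_norm (hK : 0 < K) (hc : 0 < c) (hcN : ∀ x, c * ‖x‖ ≤ Nm x)
    (hf : LipschitzWith L f) (hε : 0 < ε) (z h : Fin n → ℝ) :
    (f (z + ε • h) - f z) / ε - K / 2 * Nm h ^ 2 ≤ L * ‖h‖ - K / 2 * (c * ‖h‖) ^ 2 := by
  have h1 : (f (z + ε • h) - f z) / ε ≤ L * ‖h‖ := by
    rw [div_le_iff₀ hε]
    have := hf.dist_le_mul (z + ε • h) z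
    rw [Real.dist_eq, dist_eq_norm, add_sub_cancel_left, norm_smul, Real.norm_of_nonneg hε.le]
      at this
    calc f (z + ε • h) - f z ≤ _ := le_abs_self _
      _ ≤ _ := this
      _ = _ := by ring
  have h2 : (c * ‖h‖) ^ 2 ≤ Nm h ^ 2 := pow_le_pow_left₀ (by positivity) (hcN h) 2
  have := mul_le_mul_of_nonneg_left h2 (half_pos hK).le
  linarith

theorem mul_sub_sq_le (hK : 0 < K) (D s : ℝ) : D * s - K / 2 * s ^ 2 ≤ D ^ 2 / (2 * K) := by
  rw [le_div_iff₀ (by positivity)]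
  nlinarith [sq_nonneg (K * s - D)]

theorem quadSlope_term_le (hK : 0 < K) (hc : 0 < c) (hcN : ∀ x, c * ‖x‖ ≤ Nm x)
    (hf : LipschitzWith L f) (hε : 0 < ε) (z h : Fin n → ℝ) :
    (f (z + ε • h) - f z) / ε - K / 2 * Nm h ^ 2 ≤ (L / c) ^ 2 / (2 * K) := by
  refine (quadSlope_term_le_norm hK hc hcN hf hε z h).trans ?_
  have := mul_sub_sq_le hK (L / c) (c * ‖h‖)
  rwa [show (L : ℝ) / c * (c * ‖h‖) = L * ‖h‖ by field_simp] at this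

theorem bddAbove_quadSlope (hK : 0 < K) (hc : 0 < c) (hcN : ∀ x, c * ‖x‖ ≤ Nm x)
    (hf : LipschitzWith L f) (hε : 0 < ε) (z : Fin n → ℝ) :
    BddAbove (range fun h : Fin n → ℝ => (f (z + ε • h) - f z) / ε - K / 2 * Nm h ^ 2) :=
  ⟨_, forall_mem_range.2 (quadSlope_term_le hK hc hcN hf hε z)⟩

theorem quadSlope_nonneg (hK : 0 < K) (hc : 0 < c) (hcN : ∀ x, c * ‖x‖ ≤ Nm x) (hN0 : Nm 0 = 0)
    (hf : LipschitzWith L f) (hε : 0 < ε) (z : Fin n → ℝ) : 0 ≤ quadSlope Nm K f ε z :=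
  (by simp [hN0] : (0 : ℝ) ≤ _).trans (le_ciSup (bddAbove_quadSlope hK hc hcN hf hε z) 0)

theorem quadSlope_le (hK : 0 < K) (hc : 0 < c) (hcN : ∀ x, c * ‖x‖ ≤ Nm x)
    (hf : LipschitzWith L f) (hε : 0 < ε) (z : Fin n → ℝ) :
    quadSlope Nm K f ε z ≤ (L / c) ^ 2 / (2 * K) :=
  ciSup_le (quadSlope_term_le hK hc hcN hf hε z)

theorem measurable_quadSlope (hK : 0 < K) (hc : 0 < c) (hcN : ∀ x, c * ‖x‖ ≤ Nm x)
    (hf : LipschitzWith L f) (hε : 0 < ε) : Measurable (quadSlope Nm K f ε) := by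
  refine (lowerSemicontinuous_ciSup (bddAbove_quadSlope hK hc hcN hf hε) fun h => ?_).measurable
  have := hf.continuous
  exact Continuous.lowerSemicontinuous (by fun_prop)

theorem mul_le_add_quadSlope (hK : 0 < K) (hc : 0 < c) (hcN : ∀ x, c * ‖x‖ ≤ Nm x)
    (hNhomog : ∀ c : ℝ, 0 < c → ∀ x : Fin n → ℝ, Nm (c • x) = c * Nm x)
    (hf : LipschitzWith L f) (hε : 0 < ε) (y z : Fin n → ℝ) :
    ε * f y ≤ ε * f z + ε ^ 2 * quadSlope Nm K f ε z + K / 2 * Nm (y - z) ^ 2 := by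
  have h := le_ciSup (bddAbove_quadSlope hK hc hcN hf hε z) (ε⁻¹ • (y - z))
  change _ ≤ quadSlope Nm K f ε z at h
  rw [smul_inv_smul₀ hε.ne', add_sub_cancel, hNhomog _ (inv_pos.2 hε)] at h
  have h2 := mul_le_mul_of_nonneg_left h (sq_nonneg ε)
  have h3 : ε ^ 2 * ((f y - f z) / ε - K / 2 * (ε⁻¹ * Nm (y - z)) ^ 2) =
      ε * (f y - f z) - K / 2 * Nm (y - z) ^ 2 := by field_simp
  rw [h3] at h2
  linarith

theorem eventually_quadSlope_le (hK : 0 < K) (hc : 0 < c) (hcN : ∀ x, c * ‖x‖ ≤ Nm x)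
    (hNpos : ∀ x : Fin n → ℝ, x ≠ 0 → 0 < Nm x) (hN0 : Nm 0 = 0)
    (hNhomog : ∀ c : ℝ, 0 < c → ∀ x : Fin n → ℝ, Nm (c • x) = c * Nm x)
    (hf : LipschitzWith L f) {z : Fin n → ℝ} (hz : DifferentiableAt ℝ f z) {δ : ℝ} (hδ : 0 < δ) :
    ∀ᶠ ε in 𝓝[>] (0 : ℝ),
      quadSlope Nm K f ε z ≤ dualNorm Nm (fderiv ℝ f z) ^ 2 / (2 * K) + δ := by
  set D := dualNorm Nm (fderiv ℝ f z)
  obtain ⟨R, hR, hLR⟩ : ∃ R > 0, (L : ℝ) ≤ K / 2 * c ^ 2 * R := by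
    refine ⟨L / (K / 2 * c ^ 2) + 1, by positivity, ?_⟩
    rw [mul_add, mul_div_cancel₀ _ (by positivity)]
    have : 0 < K / 2 * c ^ 2 * 1 := by positivity
    linarith
  have hlin := hz.hasFDerivAt.isLittleO.def (div_pos hδ hR)
  obtain ⟨ρ, hρ, hball⟩ := Metric.eventually_nhds_iff.1 hlin
  filter_upwards [Ioo_mem_nhdsGT (div_pos hρ hR)] with ε hε
  refine ciSup_le fun h => ?_
  have hD0 : 0 ≤ D ^ 2 / (2 * K) := by positivity
  rcases le_total R ‖h‖ with hRh | hRh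
  · refine (quadSlope_term_le_norm hK hc hcN hf hε.1 z h).trans ?_
    have h1 : (L : ℝ) ≤ K / 2 * c ^ 2 * ‖h‖ := hLR.trans (by gcongr)
    have h2 := mul_le_mul_of_nonneg_right h1 (norm_nonneg h)
    nlinarith
  · have hlt : ε * R < ρ := (lt_div_iff₀ hR).1 hε.2
    have hnorm : ‖ε • h‖ = ε * ‖h‖ := by rw [norm_smul, Real.norm_of_nonneg hε.1.le]
    have hdist : dist (z + ε • h) z < ρ := by
      rw [dist_eq_norm, add_sub_cancel_left, hnorm]
      exact (mul_le_mul_of_nonneg_left hRh hε.1.le).trans_lt hlt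
    have h1 := (le_abs_self _).trans (hball hdist)
    rw [add_sub_cancel_left, hnorm, map_smul, smul_eq_mul] at h1
    have h2 : (f (z + ε • h) - f z) / ε ≤ fderiv ℝ f z h + δ := by
      rw [div_le_iff₀ hε.1]
      have h3 : δ / R * (ε * ‖h‖) ≤ δ / R * (ε * R) := by
        have := hε.1
        gcongr
      have h4 : δ / R * (ε * R) = δ * ε := by field_simp
      linarith
    have h5 := apply_le_dualNorm_mul hc hcN hNpos hN0 hNhomog (fderiv ℝ f z) h
    have h6 := mul_sub_sq_le hK D (Nm h)
    linarith

end AsymmetricNorm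

theorem integral_exp_le_sq_integral_exp {n : ℕ} {Nm : (Fin n → ℝ) → ℝ}
    (hNhomog : ∀ c : ℝ, 0 < c → ∀ x : Fin n → ℝ, Nm (c • x) = c * Nm x)
    {K : ℝ} {Φ : (Fin n → ℝ) → ℝ} (hΦcont : Continuous Φ)
    (hΦconv : ∀ x y : Fin n → ℝ, ∀ lam : ℝ, lam ∈ Set.Ioo (0 : ℝ) 1 →
      Φ ((1 - lam) • x + lam • y) ≤ (1 - lam) * Φ x + lam * Φ y -
        K / 2 * (1 - lam) * lam * Nm (y - x) ^ 2)
    {μ : Measure (Fin n → ℝ)}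
    (hμ : μ = volume.withDensity fun x => ENNReal.ofReal (Real.exp (-Φ x)))
    [IsProbabilityMeasure μ] {φ ψ : (Fin n → ℝ) → ℝ} (hφ : Measurable φ) (hψ : Measurable ψ)
    {A : ℝ} (hφA : ∀ x, φ x ≤ A) (hψA : ∀ x, ψ x ≤ A)
    (h : ∀ y z, φ y ≤ 2 * ψ z + K * Nm (y - z) ^ 2) :
    ∫ x, Real.exp (φ x) ∂μ ≤ (∫ x, Real.exp (ψ x) ∂μ) ^ 2 := by
  have hΦm : Measurable fun x => ENNReal.ofReal (Real.exp (-Φ x)) := by fun_prop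
  have int_exp : ∀ {u : (Fin n → ℝ) → ℝ}, Measurable u → (∀ x, u x ≤ A) →
      ENNReal.ofReal (∫ x, Real.exp (u x) ∂μ) =
        ∫⁻ x, ENNReal.ofReal (Real.exp (-Φ x)) * ENNReal.ofReal (Real.exp (u x)) := by
    intro u hu huA
    rw [ofReal_integral_eq_lintegral_ofReal
      (Integrable.of_bound hu.exp.aestronglyMeasurable (Real.exp A) (Eventually.of_forall fun x => by
        rw [Real.norm_of_nonneg (Real.exp_pos _).le]; exact Real.exp_le_exp.2 (huA x)))
      (Eventually.of_forall fun x => (Real.exp_pos _).le), hμ,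
      lintegral_withDensity_eq_lintegral_mul _ hΦm hu.exp.ennreal_ofReal]
    rfl
  have mass : ∫⁻ x, ENNReal.ofReal (Real.exp (-Φ x)) = 1 := by
    rw [← setLIntegral_univ, ← withDensity_apply _ MeasurableSet.univ, ← hμ, measure_univ]
  have key := prekopaLeindler_pi n hΦm (hΦm.mul hφ.exp.ennreal_ofReal)
    (hΦm.mul hψ.exp.ennreal_ofReal) fun x y => by
      have hconv := hΦconv x y 2⁻¹ (by norm_num)
      have hmid : (1 - (2 : ℝ)⁻¹) • x + (2 : ℝ)⁻¹ • y = (2 : ℝ)⁻¹ • (x + y) := by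
        module
      have hdiff : y - x = (2 : ℝ) • (y - (2 : ℝ)⁻¹ • (x + y)) := by module
      rw [hmid, hdiff, hNhomog 2 two_pos] at hconv
      have hy := h y ((2 : ℝ)⁻¹ • (x + y))
      simp only [Pi.mul_apply]
      simp only [← ENNReal.ofReal_mul (Real.exp_pos _).le, ← Real.exp_add,
        ← ENNReal.ofReal_pow (Real.exp_pos _).le, ← Real.exp_nat_mul]
      refine ENNReal.ofReal_le_ofReal (Real.exp_le_exp.2 ?_)
      push_cast
      linarith
  simp only [Pi.mul_apply] at key
  rw [mass, one_mul, ← int_exp hφ hφA, ← int_exp hψ hψA, ← ENNReal.ofReal_pow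
    (integral_nonneg fun x => (Real.exp_pos _).le)] at key
  exact (ENNReal.ofReal_le_ofReal_iff (by positivity)).1 key

/-- **Global Poincaré inequality on normed spaces.**
Let `Nm` be an asymmetric norm on `ℝⁿ` (`n ≥ 2`), `Φ` continuous and `K`-convex
with `K > 0`, and `𝔪 = e^{-Φ}·Leb` a probability measure. Then every Lipschitz
function `f` with compact support satisfies
`∫ f² d𝔪 − (∫ f d𝔪)² ≤ (1/K) ∫ ‖Df‖_*² d𝔪`
(the derivative `Df` exists Lebesgue-a.e. by Rademacher's theorem, and `fderiv`
is interpreted with its junk value `0` on the remaining null set). -/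
theorem poincare_inequality_asymmetric_norm {n : ℕ} (hn : 2 ≤ n)
    (Nm : (Fin n → ℝ) → ℝ) (hNcont : Continuous Nm) (hNnonneg : ∀ x, 0 ≤ Nm x)
    (hNpos : ∀ x : Fin n → ℝ, x ≠ 0 → 0 < Nm x)
    (hNhomog : ∀ c : ℝ, 0 < c → ∀ x : Fin n → ℝ, Nm (c • x) = c * Nm x)
    (hNtriangle : ∀ x y : Fin n → ℝ, Nm (x + y) ≤ Nm x + Nm y)
    (K : ℝ) (hK : 0 < K)
    (Φ : (Fin n → ℝ) → ℝ) (hΦcont : Continuous Φ)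
    (hΦconv : ∀ x y : Fin n → ℝ, ∀ lam : ℝ, lam ∈ Set.Ioo (0 : ℝ) 1 →
      Φ ((1 - lam) • x + lam • y) ≤ (1 - lam) * Φ x + lam * Φ y -
        K / 2 * (1 - lam) * lam * Nm (y - x) ^ 2)
    (𝔪 : Measure (Fin n → ℝ))
    (h𝔪 : 𝔪 = volume.withDensity fun x => ENNReal.ofReal (Real.exp (-Φ x)))
    (hprob : IsProbabilityMeasure 𝔪)
    (f : (Fin n → ℝ) → ℝ) (L : NNReal) (hf : LipschitzWith L f)
    (hfsupp : HasCompactSupport f) :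
    ∫ x, f x ^ 2 ∂𝔪 - (∫ x, f x ∂𝔪) ^ 2 ≤
      (1 / K) * ∫ x, dualNorm Nm (fderiv ℝ f x) ^ 2 ∂𝔪 := by
  obtain ⟨c, hc, hcN⟩ := exists_pos_mul_norm_le hNcont hNpos hNnonneg hNhomog
  have hN0 := apply_zero_of_homog hNhomog
  obtain ⟨M, hM⟩ := hfsupp.exists_bound_of_continuous hf.continuous
  set C : ℝ := (L / c) ^ 2 / (2 * K) with hC
  set D : (Fin n → ℝ) → ℝ := fun x => dualNorm Nm (fderiv ℝ f x) ^ 2 / (2 * K) with hD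
  set S := M + C
  have hM0 : 0 ≤ M := (norm_nonneg _).trans (hM 0)
  have hC0 : 0 ≤ C := by positivity
  have hDm : Measurable D :=
    (((measurable_dualNorm hc hcN).comp (measurable_fderiv ℝ f)).pow_const 2).div_const _
  have hDC : ∀ x, D x ≤ C := fun x => by
    have h1 := dualNorm_le hc hcN hN0 (fderiv ℝ f x)
    have h2 : ‖fderiv ℝ f x‖ ≤ L := norm_fderiv_le_of_lipschitz ℝ hf
    have h3 := dualNorm_nonneg hc hcN hN0 (fderiv ℝ f x)
    have h4 : ‖fderiv ℝ f x‖ / c ≤ L / c := by gcongr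
    simp only [hD, hC]
    gcongr
    exact h1.trans h4
  have hD0 : ∀ x, 0 ≤ D x := fun x => by positivity
  set g : ℝ → (Fin n → ℝ) → ℝ := fun ε x => max (quadSlope Nm K f ε x) (D x)
  have hgm : ∀ {ε}, 0 < ε → Measurable (g ε) := fun hε =>
    (measurable_quadSlope hK hc hcN hf hε).max hDm
  have hg0 : ∀ ε x, 0 ≤ g ε x := fun ε x => (hD0 x).trans (le_max_right _ _)
  have hgC : ∀ {ε}, 0 < ε → ∀ x, g ε x ≤ C := fun hε x =>
    max_le (quadSlope_le hK hc hcN hf hε x) (hDC x)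
  have hsmall : ∀ᶠ ε in 𝓝[>] (0 : ℝ), 0 < ε ∧ ε ≤ 1 ∧ 2 * (ε * S) ≤ 1 := by
    have h1 : Tendsto (fun ε : ℝ => 2 * (ε * S)) (𝓝 0) (𝓝 0) := by
      have : Continuous fun ε : ℝ => 2 * (ε * S) := by fun_prop
      simpa using this.tendsto 0
    filter_upwards [Ioo_mem_nhdsGT one_pos,
      nhdsWithin_le_nhds (h1.eventually_lt_const one_pos)] with ε hε hεS
    exact ⟨hε.1, hε.2.le, hεS.le⟩
  have hexpand : ∀ᶠ ε in 𝓝[>] (0 : ℝ), ∫ x, f x ^ 2 ∂𝔪 ≤ 2 * ∫ x, g ε x ∂𝔪 +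
      ((∫ x, f x ∂𝔪) + ε * ((∫ x, f x ^ 2 ∂𝔪) / 2 + ∫ x, g ε x ∂𝔪) +
        (S ^ 2 + 8 * S ^ 3) * ε ^ 2) ^ 2 + 3 * (S ^ 2 + 8 * S ^ 3) * ε := by
    filter_upwards [hsmall] with ε ⟨hε, hε1, hεS⟩
    have hfε : ∀ x, ε * f x ≤ ε * M := fun x =>
      mul_le_mul_of_nonneg_left ((le_abs_self _).trans (hM x)) hε.le
    refine integral_sq_le_of_integral_exp_le hf.continuous.measurable (hgm hε) hM (hg0 ε)
      (hgC hε) hε hε1 hεS ?_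
    have hfm := hf.continuous.measurable
    have hgm' := hgm hε
    refine integral_exp_le_sq_integral_exp hNhomog hΦcont hΦconv h𝔪 (by fun_prop) (by fun_prop)
      (A := 2 * (ε * M) + ε ^ 2 * C) (fun x => ?_) (fun x => ?_) fun y z => ?_
    · have := hfε x
      have : 0 ≤ ε ^ 2 * C := by positivity
      linarith
    · have := hfε x
      have : ε ^ 2 * g ε x ≤ ε ^ 2 * C := mul_le_mul_of_nonneg_left (hgC hε x) (sq_nonneg ε)
      have : 0 ≤ ε * M := by positivity
      linarith
    · have h1 := mul_le_add_quadSlope hK hc hcN hNhomog hf hε y z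
      have h2 : ε ^ 2 * quadSlope Nm K f ε z ≤ ε ^ 2 * g ε z :=
        mul_le_mul_of_nonneg_left (le_max_left _ _) (sq_nonneg ε)
      linarith
  have hlim : Tendsto (fun ε => ∫ x, g ε x ∂𝔪) (𝓝[>] 0) (𝓝 (∫ x, D x ∂𝔪)) := by
    refine tendsto_integral_filter_of_dominated_convergence (fun _ => C) ?_ ?_
      (integrable_const C) ?_
    · filter_upwards [self_mem_nhdsWithin] with ε hε using (hgm hε).aestronglyMeasurable
    · filter_upwards [self_mem_nhdsWithin] with ε hε
      refine Eventually.of_forall fun x => ?_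
      rw [Real.norm_of_nonneg (hg0 ε x)]
      exact hgC hε x
    · have hae : ∀ᵐ x ∂𝔪, DifferentiableAt ℝ f x := by
        rw [h𝔪]
        exact (withDensity_absolutelyContinuous _ _).ae_le hf.ae_differentiableAt
      filter_upwards [hae] with x hx
      refine tendsto_order.2 ⟨fun a ha => Eventually.of_forall fun ε =>
        ha.trans_le (le_max_right _ _), fun a ha => ?_⟩
      filter_upwards [eventually_quadSlope_le hK hc hcN hNpos hN0 hNhomog hf hx
        (half_pos (sub_pos.2 ha))] with ε hε
      refine max_lt (hε.trans_lt ?_) ha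
      change D x + _ < a
      linarith
  have hε0 : Tendsto (fun ε : ℝ => ε) (𝓝[>] 0) (𝓝 0) := nhdsWithin_le_nhds
  have hrhs := ((hlim.const_mul 2).add ((((hε0.mul (hlim.const_add
    ((∫ x, f x ^ 2 ∂𝔪) / 2))).const_add (∫ x, f x ∂𝔪)).add
    ((hε0.pow 2).const_mul (S ^ 2 + 8 * S ^ 3))).pow 2)).add
    (hε0.const_mul (3 * (S ^ 2 + 8 * S ^ 3)))
  have hfinal := ge_of_tendsto hrhs hexpand
  have hDint : ∫ x, D x ∂𝔪 = (∫ x, dualNorm Nm (fderiv ℝ f x) ^ 2 ∂𝔪) / (2 * K) :=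
    integral_div _ _
  rw [hDint] at hfinal
  have hhalf : 2 * ((∫ x, dualNorm Nm (fderiv ℝ f x) ^ 2 ∂𝔪) / (2 * K)) =
      1 / K * ∫ x, dualNorm Nm (fderiv ℝ f x) ^ 2 ∂𝔪 := by field_simp
  rw [hhalf] at hfinal
  simp only [zero_mul, add_zero, ne_eq, OfNat.ofNat_ne_zero, not_false_eq_true, zero_pow,
    mul_zero] at hfinal
  linarith
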